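/- arXiv:2401.10468 — 3 statements merged into one kernel-verified Lean document; each statement's English description precedes it below -/
import Mathlib

section
/- Let λ ≥ 2 be an integer and let c be a real number with 0 < c < 1/(λ·((λ−1)²+1)). Then there exists a positive integer K such that every connected k-regular finite simple graph G with λmin(G) ≥ −λ and k ≥ K has clique number ω(G) ≥ c·k. -/
open Classical in
/-- `G.adjEigenvalue μ` means that `μ` is an eigenvalue of the (real) adjacency matrix of the
finite simple graph `G`. -/
def SimpleGraph.adjEigenvalue {V : Type*} [Fintype V] (G : SimpleGraph V) (μ : ℝ) : Prop :=
  ∃ w : V → ℝ, w ≠ 0 ∧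
    Matrix.mulVec (Matrix.of fun i j => if G.Adj i j then (1 : ℝ) else 0) w = μ • w

open scoped InnerProductSpace

namespace SimpleGraph

/-- Any sufficiently large set of vertices contains a clique of size `a` or an independent set of
size `b`. -/
theorem exists_isClique_or_isIndepSet_subset (a b : ℕ) :
    ∃ N : ℕ, ∀ (V : Type) (G : SimpleGraph V) (S : Finset V), N ≤ S.card →
      (∃ C ⊆ S, G.IsClique (C : Set V) ∧ C.card = a) ∨
        ∃ I ⊆ S, G.IsIndepSet (I : Set V) ∧ I.card = b := by
  classical
  induction a generalizing b with
  | zero => exact ⟨0, fun V G S _ => Or.inl ⟨∅, by simp⟩⟩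
  | succ a iha =>
    induction b with
    | zero => exact ⟨0, fun V G S _ => Or.inr ⟨∅, by simp⟩⟩
    | succ b ihb =>
      obtain ⟨N₁, h₁⟩ := iha (b + 1)
      obtain ⟨N₂, h₂⟩ := ihb
      refine ⟨N₁ + N₂ + 1, fun V G S hS => ?_⟩
      obtain ⟨v, hv⟩ : S.Nonempty := by
        rw [← Finset.card_pos]; omega
      have hcard := Finset.card_filter_add_card_filter_not (s := S.erase v) (fun u => G.Adj v u)
      rw [Finset.card_erase_of_mem hv] at hcard
      rcases le_or_gt N₁ ((S.erase v).filter (fun u => G.Adj v u)).card with hN | hN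
      · rcases h₁ V G _ hN with ⟨C, hCS, hC, hCa⟩ | ⟨I, hIS, hI, hIb⟩
        · have hCS' : ∀ u ∈ C, u ∈ S ∧ G.Adj v u := fun u hu => by
            have := hCS hu
            simp only [Finset.mem_filter, Finset.mem_erase] at this
            exact ⟨this.1.2, this.2⟩
          refine Or.inl ⟨insert v C, ?_, ?_, ?_⟩
          · exact Finset.insert_subset hv fun u hu => (hCS' u hu).1
          · rw [Finset.coe_insert, isClique_insert]
            exact ⟨hC, fun u hu _ => (hCS' u hu).2⟩
          · rw [Finset.card_insert_of_notMem fun h => G.irrefl (hCS' v h).2, hCa]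
        · exact Or.inr ⟨I, fun u hu => Finset.mem_of_mem_erase
            (Finset.mem_of_mem_filter u (hIS hu)), hI, hIb⟩
      · rcases h₂ V G ((S.erase v).filter (fun u => ¬ G.Adj v u)) (by omega) with
          ⟨C, hCS, hC, hCa⟩ | ⟨I, hIS, hI, hIb⟩
        · exact Or.inl ⟨C, fun u hu => Finset.mem_of_mem_erase
            (Finset.mem_of_mem_filter u (hCS hu)), hC, hCa⟩
        · have hIS' : ∀ u ∈ I, u ∈ S ∧ u ≠ v ∧ ¬ G.Adj v u := fun u hu => by
            have := hIS hu
            simp only [Finset.mem_filter, Finset.mem_erase] at this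
            exact ⟨this.1.2, this.1.1, this.2⟩
          refine Or.inr ⟨insert v I, ?_, ?_, ?_⟩
          · exact Finset.insert_subset hv fun u hu => (hIS' u hu).1
          · have : Std.Symm fun u w => ¬ G.Adj u w := ⟨fun u w h h' => h h'.symm⟩
            rw [Finset.coe_insert, isIndepSet_iff, Set.pairwise_insert_of_symm]
            exact ⟨hI, fun u hu _ => (hIS' u hu).2.2⟩
          · rw [Finset.card_insert_of_notMem fun h => (hIS' v h).2.1 rfl, hIb]

/-- A set of vertices each of which has at most `D` non-neighbours in it contains at most
`(D + 1) * ω(G)` vertices. -/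
theorem card_le_mul_cliqueNum {V : Type*} [Fintype V] (G : SimpleGraph V) (S : Finset V) (D : ℕ)
    (h : ∀ v ∈ S, ∀ T ⊆ S, (∀ u ∈ T, u ≠ v ∧ ¬ G.Adj v u) → T.card ≤ D) :
    S.card ≤ (D + 1) * G.cliqueNum := by
  classical
  obtain ⟨C, hC⟩ := (S.powerset.filter fun C : Finset V => G.IsClique (C : Set V)).exists_maximal
    ⟨∅, by simp⟩
  have hmem := hC.prop
  rw [Finset.mem_filter, Finset.mem_powerset] at hmem
  have hcover : S ⊆ C.biUnion fun v => insert v (S.filter fun u => u ≠ v ∧ ¬ G.Adj v u) := by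
    intro u hu
    by_contra hcon
    simp only [Finset.mem_biUnion, Finset.mem_insert, Finset.mem_filter, not_exists, not_and,
      not_or, not_not] at hcon
    have huC : u ∈ C := by
      refine hC.le_of_ge (y := insert u C) ?_ (Finset.subset_insert u C) (Finset.mem_insert_self u C)
      rw [Finset.mem_filter, Finset.mem_powerset, Finset.coe_insert, isClique_insert]
      refine ⟨Finset.insert_subset hu hmem.1, hmem.2, fun v hv huv => ?_⟩
      exact ((hcon v hv).2 hu huv).symm
    exact (hcon u huC).1 rfl
  calc S.card ≤ _ := Finset.card_le_card hcover
    _ ≤ C.card * (D + 1) := by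
      refine Finset.card_biUnion_le_card_mul _ _ _ fun v hv => ?_
      refine (Finset.card_insert_le _ _).trans (Nat.succ_le_succ ?_)
      exact h v (hmem.1 hv) _ (Finset.filter_subset _ _) fun u hu => (Finset.mem_filter.mp hu).2
    _ ≤ G.cliqueNum * (D + 1) := Nat.mul_le_mul_right _ hmem.2.card_le_cliqueNum
    _ = (D + 1) * G.cliqueNum := Nat.mul_comm _ _

/-- The vectors `x v` realise the matrix `A(G) + L • I` as a Gram matrix. -/
structure IsGramRep {V E : Type*} [NormedAddCommGroup E] [InnerProductSpace ℝ E]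
    (G : SimpleGraph V) (L : ℝ) (x : V → E) : Prop where
  inner_self : ∀ v, ⟪x v, x v⟫_ℝ = L
  inner_adj : ∀ u v, G.Adj u v → ⟪x u, x v⟫_ℝ = 1
  inner_not_adj : ∀ u v, u ≠ v → ¬ G.Adj u v → ⟪x u, x v⟫_ℝ = 0

open scoped MatrixOrder in
/-- A graph whose adjacency eigenvalues are at least `-L` has a Gram representation. -/
theorem exists_isGramRep {V : Type*} [Fintype V] (G : SimpleGraph V) (L : ℝ)
    (h : ∀ μ : ℝ, G.adjEigenvalue μ → -L ≤ μ) :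
    ∃ x : V → EuclideanSpace ℝ V, G.IsGramRep L x := by
  classical
  set A : Matrix V V ℝ := G.adjMatrix ℝ + L • 1 with hA
  have hAh : A.IsHermitian := by
    refine Matrix.IsHermitian.ext fun i j => ?_
    simp [hA, Matrix.one_apply, adj_comm, eq_comm]
  have hpsd : A.PosSemidef := by
    rw [hAh.posSemidef_iff_eigenvalues_nonneg]
    intro j
    have hj := hAh.mulVec_eigenvectorBasis j
    have hne : (hAh.eigenvectorBasis j).ofLp ≠ 0 := by
      have := hAh.eigenvectorBasis.orthonormal.ne_zero j
      simpa using this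
    have hmul : ∀ w, A.mulVec w = (G.adjMatrix ℝ).mulVec w + L • w := fun w => by
      rw [hA, Matrix.add_mulVec, Matrix.smul_mulVec, Matrix.one_mulVec]
    rw [hmul] at hj
    have hadj : (G.adjMatrix ℝ).mulVec (hAh.eigenvectorBasis j).ofLp =
        (hAh.eigenvalues j - L) • (hAh.eigenvectorBasis j).ofLp := by
      rw [sub_smul, ← hj, add_sub_cancel_right]
    have := h (hAh.eigenvalues j - L) ⟨_, hne, by
      convert hadj
      ext i j
      simp [adjMatrix_apply]⟩
    simp only [Pi.zero_apply]
    linarith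
  obtain ⟨B, hB⟩ := CStarAlgebra.nonneg_iff_eq_star_mul_self.mp hpsd.nonneg
  have hinner : ∀ u v, ⟪WithLp.toLp 2 fun i => B i u, (WithLp.toLp 2 fun i => B i v :
      EuclideanSpace ℝ V)⟫_ℝ = A u v := fun u v => by
    rw [hB, Matrix.mul_apply, PiLp.inner_apply]
    simp [Matrix.star_apply, mul_comm]
  refine ⟨fun v => WithLp.toLp 2 fun i => B i v, ⟨fun v => ?_, fun u v huv => ?_, fun u v hne huv => ?_⟩⟩
  · rw [hinner]; simp [hA]
  · rw [hinner]; simp [hA, huv, huv.ne]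
  · rw [hinner]; simp [hA, huv, hne]

end SimpleGraph

/-- If `‖a • y₀ + ∑ i ∈ s, y i‖²` is expanded, upper bounds on the inner products give an upper
bound on this nonnegative quantity. -/
theorem nonneg_of_inner_le {ι E : Type*} [NormedAddCommGroup E] [InnerProductSpace ℝ E]
    (s : Finset ι) (y₀ : E) (y : ι → E) {a α β δ γ : ℝ} (ha : 0 ≤ a) (hγ : 0 ≤ γ)
    (h₀ : ⟪y₀, y₀⟫_ℝ ≤ α) (h₁ : ∀ i ∈ s, ⟪y₀, y i⟫_ℝ ≤ β) (h₂ : ∀ i ∈ s, ⟪y i, y i⟫_ℝ ≤ δ)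
    (h₃ : ∀ i ∈ s, ∀ j ∈ s, i ≠ j → ⟪y i, y j⟫_ℝ ≤ γ) :
    0 ≤ a ^ 2 * α + 2 * a * (s.card * β) + s.card * (δ + s.card * γ) := by
  classical
  have hexp : ⟪a • y₀ + ∑ i ∈ s, y i, a • y₀ + ∑ i ∈ s, y i⟫_ℝ =
      a ^ 2 * ⟪y₀, y₀⟫_ℝ + 2 * a * ∑ i ∈ s, ⟪y₀, y i⟫_ℝ + ∑ i ∈ s, ∑ j ∈ s, ⟪y i, y j⟫_ℝ := by
    rw [real_inner_add_add_self, real_inner_smul_left, real_inner_smul_left, real_inner_smul_right]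
    simp only [sum_inner, inner_sum]
    rw [Finset.sum_comm]
    ring
  have hs₁ : ∑ i ∈ s, ⟪y₀, y i⟫_ℝ ≤ s.card * β := by
    simpa using Finset.sum_le_card_nsmul s _ β h₁
  have hs₂ : ∑ i ∈ s, ∑ j ∈ s, ⟪y i, y j⟫_ℝ ≤ s.card * (δ + s.card * γ) := by
    have : ∀ i ∈ s, ∑ j ∈ s, ⟪y i, y j⟫_ℝ ≤ δ + s.card * γ := fun i hi => by
      rw [← Finset.add_sum_erase s _ hi]
      refine add_le_add (h₂ i hi) ?_
      calc _ ≤ ((s.erase i).card : ℝ) * γ := by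
            simpa using Finset.sum_le_card_nsmul (s.erase i) _ γ fun j hj =>
              h₃ i hi j (Finset.mem_of_mem_erase hj) (Finset.ne_of_mem_erase hj).symm
        _ ≤ _ := by gcongr; exact Finset.erase_subset i s
    simpa only [nsmul_eq_mul] using Finset.sum_le_card_nsmul s _ _ this
  have := real_inner_self_nonneg (x := a • y₀ + ∑ i ∈ s, y i)
  rw [hexp] at this
  have e₀ := mul_le_mul_of_nonneg_left h₀ (sq_nonneg a)
  have e₁ := mul_le_mul_of_nonneg_left hs₁ (mul_nonneg zero_le_two ha)
  linarith

/-- The average of the vectors `x u` over `u ∈ C`. -/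
noncomputable def finsetMean {V E : Type*} [NormedAddCommGroup E] [InnerProductSpace ℝ E]
    (x : V → E) (C : Finset V) : E :=
  (C.card : ℝ)⁻¹ • ∑ u ∈ C, x u

namespace SimpleGraph.IsGramRep

variable {V E : Type*} [NormedAddCommGroup E] [InnerProductSpace ℝ E] {G : SimpleGraph V} {L : ℝ}
  {x : V → E}

theorem inner_sum_clique (hx : G.IsGramRep L x) {C : Finset V} (hC : G.IsClique (C : Set V))
    {u : V} (hu : u ∈ C) (α : V → ℝ) :
    ⟪x u, ∑ w ∈ C, α w • x w⟫_ℝ = ∑ w ∈ C, α w + (L - 1) * α u := by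
  classical
  rw [inner_sum, ← Finset.add_sum_erase C _ hu, ← Finset.add_sum_erase C α hu,
    real_inner_smul_right, hx.inner_self]
  have : ∑ w ∈ C.erase u, ⟪x u, α w • x w⟫_ℝ = ∑ w ∈ C.erase u, α w :=
    Finset.sum_congr rfl fun w hw => by
      have hne := Finset.ne_of_mem_erase hw
      rw [real_inner_smul_right, hx.inner_adj u w (hC hu (Finset.mem_of_mem_erase hw) hne.symm),
        mul_one]
  rw [this]
  ring

theorem inner_self_sum_clique (hx : G.IsGramRep L x) {C : Finset V}
    (hC : G.IsClique (C : Set V)) (α : V → ℝ) :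
    ⟪∑ w ∈ C, α w • x w, ∑ w ∈ C, α w • x w⟫_ℝ =
      (∑ w ∈ C, α w) ^ 2 + (L - 1) * ∑ w ∈ C, α w ^ 2 := by
  rw [sum_inner, sq, Finset.sum_mul, Finset.mul_sum, ← Finset.sum_add_distrib]
  refine Finset.sum_congr rfl fun u hu => ?_
  rw [real_inner_smul_left, hx.inner_sum_clique hC hu]
  ring

theorem inner_finsetMean_of_mem (hx : G.IsGramRep L x) {C : Finset V}
    (hC : G.IsClique (C : Set V)) {u : V} (hu : u ∈ C) :
    ⟪x u, finsetMean x C⟫_ℝ = 1 + (L - 1) / C.card := by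
  have hpos : (C.card : ℝ) ≠ 0 := by
    exact_mod_cast (Finset.card_pos.mpr ⟨u, hu⟩).ne'
  have := hx.inner_sum_clique hC hu fun _ => 1
  simp only [one_smul, Finset.sum_const, nsmul_eq_mul, mul_one] at this
  rw [finsetMean, real_inner_smul_right, this]
  field_simp

theorem inner_self_finsetMean (hx : G.IsGramRep L x) {C : Finset V}
    (hC : G.IsClique (C : Set V)) (hne : C.Nonempty) :
    ⟪finsetMean x C, finsetMean x C⟫_ℝ = 1 + (L - 1) / C.card := by
  have hpos : (C.card : ℝ) ≠ 0 := by
    exact_mod_cast (Finset.card_pos.mpr hne).ne'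
  have := hx.inner_self_sum_clique hC fun _ => 1
  simp only [one_smul, Finset.sum_const, nsmul_eq_mul, mul_one, one_pow] at this
  rw [finsetMean, real_inner_smul_right, real_inner_smul_left, this]
  field_simp

theorem inner_finsetMean_of_forall_adj (hx : G.IsGramRep L x) {C : Finset V} (hne : C.Nonempty)
    {v : V} (hv : ∀ u ∈ C, G.Adj v u) : ⟪x v, finsetMean x C⟫_ℝ = 1 := by
  have hpos : (C.card : ℝ) ≠ 0 := by
    exact_mod_cast (Finset.card_pos.mpr hne).ne'
  rw [finsetMean, real_inner_smul_right, inner_sum,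
    Finset.sum_congr rfl fun u hu => hx.inner_adj v u (hv u hu)]
  simp [hpos]

/-- The proportion of neighbours of `v` in a large clique not containing `v` is close to `0` or
to `1`. -/
theorem card_mul_inner_finsetMean_le (hx : G.IsGramRep L x) (hL : 1 ≤ L) {C : Finset V}
    (hC : G.IsClique (C : Set V)) (hne : C.Nonempty) {v : V} (hv : v ∉ C) :
    C.card * (⟪x v, finsetMean x C⟫_ℝ * (1 - ⟪x v, finsetMean x C⟫_ℝ)) ≤ L * (L - 1) := by
  have hpos : (C.card : ℝ) ≠ 0 := by
    exact_mod_cast (Finset.card_pos.mpr hne).ne'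
  set p := ⟪x v, finsetMean x C⟫_ℝ with hp
  have hsum : ∑ u ∈ C, ⟪x v, x u⟫_ℝ = C.card * p := by
    rw [hp, finsetMean, real_inner_smul_right, inner_sum, mul_inv_cancel_left₀ hpos]
  have hsq : ∑ u ∈ C, ⟪x v, x u⟫_ℝ ^ 2 = C.card * p := by
    rw [← hsum]
    refine Finset.sum_congr rfl fun u hu => ?_
    by_cases h : G.Adj v u
    · rw [hx.inner_adj v u h, one_pow]
    · rw [hx.inner_not_adj v u (fun h' => hv (h' ▸ hu)) h, zero_pow two_ne_zero]
  set α : V → ℝ := fun u => ⟪x v, x u⟫_ℝ - p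
  have hα : ∑ u ∈ C, α u = 0 := by
    simp [α, Finset.sum_sub_distrib, hsum]
  have hα₂ : ∑ u ∈ C, α u ^ 2 = C.card * (p * (1 - p)) := by
    simp only [α, sub_sq, Finset.sum_add_distrib, Finset.sum_sub_distrib, hsq, ← Finset.sum_mul,
      ← Finset.mul_sum, hsum, Finset.sum_const, nsmul_eq_mul]
    ring
  have hvα : ⟪x v, ∑ u ∈ C, α u • x u⟫_ℝ = ∑ u ∈ C, α u ^ 2 := by
    simp only [inner_sum, real_inner_smul_right]
    have : ∀ u ∈ C, α u * ⟪x v, x u⟫_ℝ = α u ^ 2 + p * α u := fun u _ => by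
      simp only [α]; ring
    rw [Finset.sum_congr rfl this, Finset.sum_add_distrib, ← Finset.mul_sum, hα]
    ring
  have hcs := real_inner_mul_inner_self_le (x v) (∑ u ∈ C, α u • x u)
  rw [hvα, hx.inner_self, hx.inner_self_sum_clique hC, hα, hα₂] at hcs
  by_contra! hlt
  have h₀ : 0 ≤ L * (L - 1) := mul_nonneg (by linarith) (by linarith)
  nlinarith

theorem inner_finsetMean_le_or_le (hx : G.IsGramRep L x) (hL : 1 ≤ L) {C : Finset V}
    (hC : G.IsClique (C : Set V)) {ε : ℝ} (hε : 0 < ε) (hε₂ : ε ≤ 1 / 2)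
    (hcard : 2 * (L * (L - 1)) < C.card * ε) (v : V) :
    ⟪x v, finsetMean x C⟫_ℝ ≤ ε ∨ 1 - ε ≤ ⟪x v, finsetMean x C⟫_ℝ := by
  have h₀ : 0 ≤ L * (L - 1) := mul_nonneg (by linarith) (by linarith)
  have hpos : (0 : ℝ) < C.card := by
    by_contra! h
    nlinarith
  by_cases hv : v ∈ C
  · right
    rw [hx.inner_finsetMean_of_mem hC hv]
    have : 0 ≤ (L - 1) / C.card := div_nonneg (by linarith) hpos.le
    linarith
  · by_contra! h
    have h₁ := hx.card_mul_inner_finsetMean_le hL hC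
      (Finset.card_pos.mp (by exact_mod_cast hpos)) hv
    have h₂ := mul_pos (sub_pos.mpr h.1) (sub_pos.mpr h.2)
    have h₃ := mul_pos hpos h₂
    have h₄ : 0 ≤ C.card * ε * (1 - ε - 1 / 2) :=
      mul_nonneg (mul_nonneg hpos.le hε.le) (by linarith)
    nlinarith

/-- An independent set in the neighbourhood of a vertex has at most `L ^ 2` vertices. -/
theorem card_le_of_isIndepSet (hx : G.IsGramRep L x) (hL : 0 < L) {I : Finset V}
    (hI : G.IsIndepSet (I : Set V)) {v : V} (hv : ∀ u ∈ I, G.Adj v u) :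
    (I.card : ℝ) ≤ L ^ 2 := by
  have := nonneg_of_inner_le I (x v) (fun u => -x u) (a := L) (α := L) (β := -1) (δ := L) (γ := 0)
    hL.le le_rfl (hx.inner_self v).le
    (fun u hu => by rw [inner_neg_right, hx.inner_adj v u (hv u hu)])
    (fun u _ => by rw [inner_neg_neg, hx.inner_self])
    (fun u hu w hw huw => by
      rw [inner_neg_neg, hx.inner_not_adj u w huw (hI hu hw huw)])
  by_contra! h
  nlinarith

/-- Among vertices whose vectors are close to a common near-unit vector, every vertex has at most
`n ^ 2` non-neighbours, where the least eigenvalue is at least `-(n + 1)`. -/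
theorem card_nonadj_le {n : ℕ} (hx : G.IsGramRep (n + 1) x) (hn : 1 ≤ n) {ε : ℝ} (hε : 0 < ε)
    (hε₁ : 4 * (n + 1) ^ 4 * ε ≤ 1) {f : E} (hf : ⟪f, f⟫_ℝ ≤ 1 + ε) {v : V}
    (hv : 1 - ε ≤ ⟪x v, f⟫_ℝ) {T : Finset V} (hT : ∀ u ∈ T, 1 - ε ≤ ⟪x u, f⟫_ℝ)
    (hnon : ∀ u ∈ T, u ≠ v ∧ ¬ G.Adj v u) : T.card ≤ n ^ 2 := by
  by_contra! hlt
  obtain ⟨S, hST, hS⟩ := Finset.exists_subset_card_eq (Nat.succ_le_of_lt hlt)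
  have key : ∀ u w, 1 - ε ≤ ⟪x u, f⟫_ℝ → 1 - ε ≤ ⟪x w, f⟫_ℝ →
      ⟪x u - f, x w - f⟫_ℝ ≤ ⟪x u, x w⟫_ℝ - 1 + 3 * ε := fun u w hu hw => by
    rw [inner_sub_left, inner_sub_right, inner_sub_right, real_inner_comm (x w) f]
    linarith
  have := nonneg_of_inner_le S (x v - f) (fun u => x u - f) (a := n) (α := n + 3 * ε)
    (β := -1 + 3 * ε) (δ := n + 3 * ε) (γ := 3 * ε) n.cast_nonneg (by positivity)
    (by have := key v v hv hv; rw [hx.inner_self] at this; linarith)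
    (fun u hu => by
      have h := key v u hv (hT u (hST hu))
      rw [hx.inner_not_adj v u (hnon u (hST hu)).1.symm (hnon u (hST hu)).2] at h
      linarith)
    (fun u hu => by
      have h := key u u (hT u (hST hu)) (hT u (hST hu))
      rw [hx.inner_self] at h
      linarith)
    (fun u hu w hw huw => by
      have h := key u w (hT u (hST hu)) (hT w (hST hw))
      by_cases ha : G.Adj u w
      · rw [hx.inner_adj u w ha] at h; linarith
      · rw [hx.inner_not_adj u w huw ha] at h; linarith)
  rw [hS] at this
  push_cast at this
  have hn' : (1 : ℝ) ≤ n := by exact_mod_cast hn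
  have hpoly : ((n : ℝ) + n ^ 2 + 1) ^ 2 + n ^ 2 + 1 ≤ (n + 1) ^ 4 := by
    have : (0 : ℝ) ≤ n ^ 3 := by positivity
    nlinarith
  have := mul_le_mul_of_nonneg_right hpoly hε.le
  nlinarith

end SimpleGraph.IsGramRep

/-- A vector of squared norm at most `n + 1` is close to at most `n + 1` almost orthonormal
vectors, in the sense of having inner product almost `1` with them. -/
theorem card_le_of_almost_orthonormal {ι E : Type*} [NormedAddCommGroup E] [InnerProductSpace ℝ E]
    {n : ℕ} {ε : ℝ} (hε : 0 < ε) (hε₁ : 4 * (n + 1) ^ 4 * ε ≤ 1) (hn : 1 ≤ n) {z : E}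
    (hz : ⟪z, z⟫_ℝ ≤ n + 1) {s : Finset ι} {f : ι → E} (hzf : ∀ i ∈ s, 1 - ε ≤ ⟪z, f i⟫_ℝ)
    (hf : ∀ i ∈ s, ⟪f i, f i⟫_ℝ ≤ 1 + ε) (hff : ∀ i ∈ s, ∀ j ∈ s, i ≠ j → ⟪f i, f j⟫_ℝ ≤ ε) :
    s.card ≤ n + 1 := by
  by_contra! hlt
  obtain ⟨t, hts, ht⟩ := Finset.exists_subset_card_eq (Nat.succ_le_of_lt hlt)
  have := nonneg_of_inner_le t z (fun i => -f i) (a := 1) (β := -(1 - ε)) zero_le_one hε.le hz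
    (fun i hi => by rw [inner_neg_right]; linarith [hzf i (hts hi)])
    (fun i hi => by rw [inner_neg_neg]; exact hf i (hts hi))
    (fun i hi j hj hij => by rw [inner_neg_neg]; exact hff i (hts hi) j (hts hj) hij)
  rw [ht] at this
  push_cast at this
  have hn' : (1 : ℝ) ≤ n := by exact_mod_cast hn
  have hpoly : ((n : ℝ) + 2) * (n + 5) < 4 * (n + 1) ^ 4 := by
    have h₂ : (0 : ℝ) ≤ n ^ 2 * (n ^ 2 + n) := by positivity
    nlinarith
  have := mul_lt_mul_of_pos_right hpoly hε
  nlinarith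

namespace SimpleGraph

/-- If every set of `N` vertices of `G` contains an `M`-clique or an independent set of size
`(n + 1) ^ 2 + 1`, and `M` is large, then the vertices whose vectors are close to the means of at
most `n + 1` suitable `M`-cliques cover all but `N` neighbours of any vertex. -/
theorem degree_le_of_isGramRep {V : Type} [Fintype V] {E : Type*} [NormedAddCommGroup E]
    [InnerProductSpace ℝ E] {G : SimpleGraph V} [DecidableRel G.Adj] {x : V → E} {n M N : ℕ}
    (hx : G.IsGramRep (n + 1) x) (hn : 1 ≤ n) {ε : ℝ} (hε : 0 < ε)
    (hε₁ : 4 * (n + 1) ^ 4 * ε ≤ 1) (hM : 2 * ((n + 1) * n) < M * ε)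
    (hN : ∀ S : Finset V, N ≤ S.card → (∃ C ⊆ S, G.IsClique (C : Set V) ∧ C.card = M) ∨
      ∃ I ⊆ S, G.IsIndepSet (I : Set V) ∧ I.card = (n + 1) ^ 2 + 1) (v : V) :
    G.degree v ≤ N + (n + 1) * ((n ^ 2 + 1) * G.cliqueNum) := by
  classical
  have hn' : (1 : ℝ) ≤ n := by exact_mod_cast hn
  have hε₂ : ε ≤ 1 / 2 := by
    have : (1 : ℝ) ≤ (n + 1) ^ 4 := one_le_pow₀ (by linarith)
    nlinarith
  have hMpos : (0 : ℝ) < M := by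
    by_contra! h
    nlinarith
  have hMε : (n : ℝ) / M ≤ ε := by
    rw [div_le_iff₀ hMpos]
    nlinarith
  set Q : Finset V → Finset V := fun C =>
    Finset.univ.filter fun u => 1 - ε ≤ ⟪x u, finsetMean x C⟫_ℝ with hQ
  have hnonempty : ∀ {C : Finset V}, C.card = M → C.Nonempty := fun h =>
    Finset.card_pos.mp (h ▸ by exact_mod_cast hMpos)
  have hself : ∀ {C : Finset V}, G.IsClique (C : Set V) → C.card = M →
      ⟪finsetMean x C, finsetMean x C⟫_ℝ ≤ 1 + ε := fun hC hcard => by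
    rw [hx.inner_self_finsetMean hC (hnonempty hcard), hcard, add_sub_cancel_right]
    linarith
  have hmemQ : ∀ {C : Finset V}, G.IsClique (C : Set V) → C ⊆ Q C := fun {C} hC u hu => by
    rw [hQ, Finset.mem_filter, hx.inner_finsetMean_of_mem hC hu, add_sub_cancel_right]
    have : (0 : ℝ) ≤ n / C.card := by positivity
    exact ⟨Finset.mem_univ u, by linarith⟩
  have hQcard : ∀ {C : Finset V}, G.IsClique (C : Set V) → C.card = M →
      (Q C).card ≤ (n ^ 2 + 1) * G.cliqueNum := fun hC hcard =>
    G.card_le_mul_cliqueNum _ _ fun u hu T hT hnon =>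
      hx.card_nonadj_le hn hε hε₁ (hself hC hcard) (Finset.mem_filter.mp hu).2
        (fun w hw => (Finset.mem_filter.mp (hT hw)).2) hnon
  obtain ⟨F, hF⟩ := (Finset.univ.filter fun F : Finset (Finset V) =>
    (∀ C ∈ F, G.IsClique (C : Set V) ∧ C.card = M ∧ C ⊆ G.neighborFinset v) ∧
    ∀ C ∈ F, ∀ D ∈ F, C ≠ D → ⟪finsetMean x C, finsetMean x D⟫_ℝ ≤ ε).exists_maximal
      ⟨∅, by simp⟩
  obtain ⟨-, hF₁, hF₂⟩ := Finset.mem_filter.mp hF.prop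
  have hFcard : F.card ≤ n + 1 := by
    refine card_le_of_almost_orthonormal hε hε₁ hn (hx.inner_self v).le (fun C hC => ?_)
      (fun C hC => hself (hF₁ C hC).1 (hF₁ C hC).2.1) hF₂
    rw [hx.inner_finsetMean_of_forall_adj (hnonempty (hF₁ C hC).2.1) fun u hu => by
      simpa using (hF₁ C hC).2.2 hu]
    linarith
  have hrest : (G.neighborFinset v \ F.biUnion Q).card < N := by
    by_contra! hlt
    rcases hN _ hlt with ⟨C, hCS, hC, hcard⟩ | ⟨I, hIS, hI, hcard⟩
    · have hCQ : ∀ D ∈ F, ∀ u ∈ C, u ∉ Q D := fun D hD u hu huD =>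
        (Finset.mem_sdiff.mp (hCS hu)).2 (Finset.mem_biUnion.mpr ⟨D, hD, huD⟩)
      have hCF : C ∉ F := fun h => by
        obtain ⟨u, hu⟩ := hnonempty hcard
        exact hCQ C h u hu (hmemQ hC hu)
      have hCD : ∀ D ∈ F, ⟪finsetMean x C, finsetMean x D⟫_ℝ ≤ ε := fun D hD => by
        rw [finsetMean, real_inner_smul_left, sum_inner, hcard, inv_mul_le_iff₀ hMpos, ← hcard,
          ← nsmul_eq_mul]
        refine Finset.sum_le_card_nsmul C _ ε fun u hu => ?_
        refine (hx.inner_finsetMean_le_or_le (by linarith) (hF₁ D hD).1 hε hε₂ ?_ u).resolve_right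
          fun h => hCQ D hD u hu (Finset.mem_filter.mpr ⟨Finset.mem_univ u, h⟩)
        rw [(hF₁ D hD).2.1, add_sub_cancel_right]
        exact hM
      refine hCF (hF.le_of_ge (y := insert C F) ?_ (Finset.subset_insert C F)
        (Finset.mem_insert_self C F))
      refine Finset.mem_filter.mpr ⟨Finset.mem_univ _, ?_, ?_⟩
      · rw [Finset.forall_mem_insert]
        exact ⟨⟨hC, hcard, hCS.trans Finset.sdiff_subset⟩, hF₁⟩
      · simp only [Finset.forall_mem_insert]
        refine ⟨⟨fun h => absurd rfl h, fun D hD _ => hCD D hD⟩, fun D hD => ⟨fun _ => ?_, hF₂ D hD⟩⟩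
        rw [real_inner_comm]
        exact hCD D hD
    · have := hx.card_le_of_isIndepSet (by positivity) hI (v := v) fun u hu => by
        simpa using (Finset.mem_sdiff.mp (hIS hu)).1
      rw [hcard] at this
      push_cast at this
      linarith
  calc G.degree v = (G.neighborFinset v).card := (G.card_neighborFinset_eq_degree v).symm
    _ ≤ (G.neighborFinset v \ F.biUnion Q).card + (F.biUnion Q).card :=
      Finset.card_le_card_sdiff_add_card
    _ ≤ N + F.card * ((n ^ 2 + 1) * G.cliqueNum) := by
      refine add_le_add hrest.le (Finset.card_biUnion_le_card_mul _ _ _ fun C hC => ?_)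
      exact hQcard (hF₁ C hC).1 (hF₁ C hC).2.1
    _ ≤ _ := by gcongr

end SimpleGraph

/-- if `λ ≥ 2` and `0 < c < 1/(λ((λ−1)²+1))`, then every connected `k`-regular graph
with smallest eigenvalue at least `-λ` and `k` large has clique number at least `c·k`. -/
theorem stmt_7 (lam : ℕ) (hlam : 2 ≤ lam) (c : ℝ) (hc0 : 0 < c)
    (hc1 : c < 1 / ((lam : ℝ) * (((lam : ℝ) - 1) ^ 2 + 1))) :
    ∃ K : ℕ, 0 < K ∧
      ∀ (V : Type) [Fintype V] [DecidableEq V] (G : SimpleGraph V) [DecidableRel G.Adj]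
        (k : ℕ), G.Connected → G.IsRegularOfDegree k →
        (∀ μ : ℝ, G.adjEigenvalue μ → -(lam : ℝ) ≤ μ) → K ≤ k →
        c * (k : ℝ) ≤ (G.cliqueNum : ℝ) := by
  obtain ⟨n, rfl⟩ : ∃ n, lam = n + 1 := ⟨lam - 1, by omega⟩
  have hn : 1 ≤ n := by omega
  push_cast at hc1
  rw [add_sub_cancel_right] at hc1
  set P : ℝ := (n + 1) * (n ^ 2 + 1) with hP
  have hPpos : 0 < P := by positivity
  have hcP : 0 < 1 - c * P := by
    rw [lt_div_iff₀ hPpos] at hc1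
    linarith
  set ε : ℝ := 1 / (4 * (n + 1) ^ 4) with hε
  have hεpos : 0 < ε := by positivity
  have hε₁ : 4 * (n + 1) ^ 4 * ε ≤ 1 := by
    rw [hε, mul_one_div_cancel (by positivity)]
  obtain ⟨M, hM⟩ := exists_nat_gt (2 * (((n : ℝ) + 1) * n) / ε)
  rw [div_lt_iff₀ hεpos] at hM
  obtain ⟨N, hN⟩ := SimpleGraph.exists_isClique_or_isIndepSet_subset M ((n + 1) ^ 2 + 1)
  obtain ⟨K, hK⟩ := exists_nat_gt (N / (1 - c * P))
  rw [div_lt_iff₀ hcP] at hK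
  refine ⟨K + 1, K.succ_pos, fun V _ _ G _ k hconn hreg heig hk => ?_⟩
  obtain ⟨x, hx⟩ := G.exists_isGramRep (n + 1) fun μ hμ => by exact_mod_cast heig μ hμ
  obtain ⟨v⟩ := hconn.nonempty
  have hdeg := SimpleGraph.degree_le_of_isGramRep hx hn hεpos hε₁ hM (hN V G) v
  rw [hreg.degree_eq v] at hdeg
  have hdeg' : (k : ℝ) ≤ N + P * G.cliqueNum := by
    rw [hP, mul_assoc]
    exact_mod_cast hdeg
  have hKk : (K : ℝ) * (1 - c * P) ≤ k * (1 - c * P) :=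
    mul_le_mul_of_nonneg_right (by exact_mod_cast (Nat.le_succ K).trans hk) hcP.le
  refine le_of_mul_le_mul_left ?_ hPpos
  linarith
end

section
/- Let λ ≥ 1 and n ≥ 2 be integers. There exists a positive integer K (one may take K to be the Ramsey number R(n−1, λ²+1)) such that in every k-regular finite simple graph G with λmin(G) ≥ −λ and k ≥ K, every vertex lies in a clique of order at least n. -/
universe u

/-- Finite Ramsey theorem for two colours, inside a finite set of vertices. -/
theorem SimpleGraph.exists_ramsey (a b : ℕ) :
    ∃ N : ℕ, ∀ (V : Type u) (G : SimpleGraph V) (S : Finset V), N ≤ S.card →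
      (∃ T ⊆ S, G.IsNClique a T) ∨ ∃ T ⊆ S, G.IsNIndepSet b T := by
  classical
  induction a generalizing b with
  | zero => exact ⟨0, fun V G S _ => Or.inl ⟨∅, by simp, by simp⟩⟩
  | succ a iha =>
    induction b with
    | zero => exact ⟨0, fun V G S _ => Or.inr ⟨∅, by simp, by simp [isNIndepSet_iff]⟩⟩
    | succ b ihb =>
      obtain ⟨M, hM⟩ := iha (b + 1)
      obtain ⟨N, hN⟩ := ihb
      refine ⟨M + N + 1, fun V G S hS => ?_⟩
      obtain ⟨v, hv⟩ : S.Nonempty := Finset.card_pos.mp (by omega)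
      have hsplit := Finset.card_filter_add_card_filter_not (s := S.erase v) (G.Adj v)
      have herase := Finset.card_erase_add_one hv
      have hsub (p : V → Prop) [DecidablePred p] : (S.erase v).filter p ⊆ S :=
        (Finset.filter_subset _ _).trans (Finset.erase_subset _ _)
      rcases (show M ≤ ((S.erase v).filter (G.Adj v)).card ∨
          N ≤ ((S.erase v).filter (¬ G.Adj v ·)).card by omega) with h | h
      · rcases hM V G _ h with ⟨T, hT, hc⟩ | ⟨T, hT, hi⟩
        · refine Or.inl ⟨insert v T, Finset.insert_subset hv (hT.trans (hsub _)),
            hc.insert fun w hw => (Finset.mem_filter.mp (hT hw)).2⟩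
        · exact Or.inr ⟨T, hT.trans (hsub _), hi⟩
      · rcases hN V G _ h with ⟨T, hT, hc⟩ | ⟨T, hT, hi⟩
        · exact Or.inl ⟨T, hT.trans (hsub _), hc⟩
        · refine Or.inr ⟨insert v T, Finset.insert_subset hv (hT.trans (hsub _)), ?_⟩
          rw [← isNClique_compl] at hi ⊢
          refine hi.insert fun w hw => ?_
          have hw' := Finset.mem_filter.mp (hT hw)
          exact (compl_adj G v w).mpr ⟨(Finset.ne_of_mem_erase hw'.1).symm, hw'.2⟩

/-- A lower bound on the eigenvalues of the adjacency matrix bounds its quadratic form. -/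
theorem SimpleGraph.quadraticForm_nonneg_of_adjEigenvalue {V : Type*} [Fintype V] [DecidableEq V]
    (G : SimpleGraph V) [DecidableRel G.Adj] (c : ℝ)
    (h : ∀ μ : ℝ, G.adjEigenvalue μ → -c ≤ μ) (w : V → ℝ) :
    0 ≤ w ⬝ᵥ (G.adjMatrix ℝ).mulVec w + c * (w ⬝ᵥ w) := by
  have hA : (G.adjMatrix ℝ + c • (1 : Matrix V V ℝ)).IsHermitian := by
    ext i j
    simp [Matrix.one_apply, G.adj_comm, eq_comm]
  have hpos : (G.adjMatrix ℝ + c • (1 : Matrix V V ℝ)).PosSemidef := by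
    rw [hA.posSemidef_iff_eigenvalues_nonneg]
    intro i
    have hev := hA.mulVec_eigenvectorBasis i
    rw [Matrix.add_mulVec, Matrix.smul_mulVec, Matrix.one_mulVec] at hev
    have hle : -c ≤ hA.eigenvalues i - c := by
      refine h _ ⟨(hA.eigenvectorBasis i).ofLp, fun h0 => ?_, ?_⟩
      · exact hA.eigenvectorBasis.orthonormal.ne_zero i ((WithLp.ofLp_eq_zero 2).mp h0)
      · rw [sub_smul, ← eq_sub_of_add_eq hev]
        congr 1
        ext i j
        simp [adjMatrix_apply]
    simp only [Pi.zero_apply]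
    linarith
  have := hpos.dotProduct_mulVec_nonneg w
  simpa [Matrix.add_mulVec, Matrix.smul_mulVec, dotProduct_add] using this

/-- If all adjacency eigenvalues are at least `-lam`, then every independent set contained in a
neighbourhood has at most `lam ^ 2` vertices. -/
theorem SimpleGraph.card_le_sq_of_isIndepSet_subset_neighborFinset {V : Type*} [Fintype V]
    [DecidableEq V] (G : SimpleGraph V) [DecidableRel G.Adj] {lam : ℝ} (hlam : 0 < lam)
    (h : ∀ μ : ℝ, G.adjEigenvalue μ → -lam ≤ μ) {x : V} {T : Finset V}
    (hT : T ⊆ G.neighborFinset x) (hi : G.IsIndepSet (T : Set V)) : (T.card : ℝ) ≤ lam ^ 2 := by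
  have hx : x ∉ T := fun hxT => by simpa using hT hxT
  have hadj : ∀ y ∈ T, G.Adj x y := fun y hy => (G.mem_neighborFinset x y).mp (hT hy)
  have hnadj : ∀ y ∈ T, ∀ z ∈ T, ¬ G.Adj y z := fun y hy z hz hyz =>
    hi (Finset.mem_coe.mpr hy) (Finset.mem_coe.mpr hz) hyz.ne hyz
  let w : V → ℝ := fun v => if v = x then -lam else if v ∈ T then 1 else 0
  have hwx : w x = -lam := by simp [w]
  have hwT : ∀ y ∈ T, w y = 1 := fun y hy => by
    simp [w, hy, ne_of_mem_of_not_mem hy hx]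
  have hsum (f : V → ℝ) : ∑ v, w v * f v = -lam * f x + ∑ y ∈ T, f y := by
    rw [← Finset.sum_subset (Finset.subset_univ (insert x T)), Finset.sum_insert hx, hwx]
    · exact congrArg _ (Finset.sum_congr rfl fun y hy => by rw [hwT y hy, one_mul])
    · intro v _ hv
      rw [Finset.mem_insert, not_or] at hv
      simp [w, hv.1, hv.2]
  have hmul (v : V) : (G.adjMatrix ℝ).mulVec w v =
      -lam * G.adjMatrix ℝ v x + ∑ y ∈ T, G.adjMatrix ℝ v y := by
    rw [← hsum]
    exact Finset.sum_congr rfl fun _ _ => mul_comm _ _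
  have hmulx : (G.adjMatrix ℝ).mulVec w x = T.card := by
    rw [hmul, Finset.sum_congr rfl fun y hy => by rw [adjMatrix_apply, if_pos (hadj y hy)]]
    simp
  have hmulT : ∀ y ∈ T, (G.adjMatrix ℝ).mulVec w y = -lam := fun y hy => by
    rw [hmul, Finset.sum_congr rfl fun z hz => by
      rw [adjMatrix_apply, if_neg (hnadj y hy z hz)]]
    simp [(hadj y hy).symm]
  have hq := G.quadraticForm_nonneg_of_adjEigenvalue lam h w
  rw [dotProduct, dotProduct, hsum, hsum, hmulx, hwx, Finset.sum_congr rfl hmulT,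
    Finset.sum_congr rfl hwT] at hq
  simp only [Finset.sum_const, nsmul_eq_mul] at hq
  refine le_of_mul_le_mul_left ?_ hlam
  nlinarith

/-- for `λ ≥ 1`, `n ≥ 2` there is `K` (e.g. the Ramsey number `R(n−1, λ²+1)`)
such that in every `k`-regular graph with smallest eigenvalue at least `-λ` and `k ≥ K`,
every vertex lies in a clique of order at least `n`. -/
theorem stmt_10 (lam n : ℕ) (hlam : 1 ≤ lam) (hn : 2 ≤ n) :
    ∃ K : ℕ, 0 < K ∧
      ∀ (V : Type) [Fintype V] [DecidableEq V] (G : SimpleGraph V) [DecidableRel G.Adj]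
        (k : ℕ), G.IsRegularOfDegree k →
        (∀ μ : ℝ, G.adjEigenvalue μ → -(lam : ℝ) ≤ μ) → K ≤ k →
        ∀ x : V, ∃ C : Finset V, x ∈ C ∧ G.IsClique (C : Set V) ∧ n ≤ C.card := by
  obtain ⟨N, hN⟩ := SimpleGraph.exists_ramsey (n - 1) (lam ^ 2 + 1)
  refine ⟨N + 1, N.succ_pos, fun V _ _ G _ k hreg hμ hk x => ?_⟩
  have hcard : N ≤ (G.neighborFinset x).card := by
    rw [G.card_neighborFinset_eq_degree, hreg.degree_eq]
    omega
  rcases hN V G _ hcard with ⟨T, hT, hc⟩ | ⟨T, hT, hi⟩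
  · have hins := hc.insert fun y hy => (G.mem_neighborFinset x y).mp (hT hy)
    exact ⟨insert x T, Finset.mem_insert_self x T, hins.isClique, by rw [hins.card_eq]; omega⟩
  · have hle := G.card_le_sq_of_isIndepSet_subset_neighborFinset
      (Nat.cast_pos.mpr hlam) hμ hT hi.isIndepSet
    rw [hi.card_eq] at hle
    norm_cast at hle
    omega
end

section
/- Let λ ≥ 1 be an integer, let G be a finite simple graph with λmin(G) ≥ −λ, and let C be a clique in G of order c. Suppose some vertex x of G outside C has exactly s neighbors in C, where λ(λ−1)+1 ≤ s ≤ c − (λ−1)² − 1. Then c ≤ (λ(λ−1))² + λ(λ−1) + (λ−1)² + 1. -/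
/-- If every adjacency eigenvalue is at least `-l`, the quadratic form of `A + l I` is
nonnegative. -/
theorem SimpleGraph.quadratic_form_nonneg {V : Type*} [Fintype V] [DecidableEq V]
    (G : SimpleGraph V) [DecidableRel G.Adj] (l : ℝ)
    (hmin : ∀ μ : ℝ, G.adjEigenvalue μ → -l ≤ μ) (w : V → ℝ) :
    0 ≤ ∑ i, w i * (l * w i + ∑ j, (if G.Adj i j then (1 : ℝ) else 0) * w j) := by
  set A : Matrix V V ℝ := Matrix.of fun i j => if G.Adj i j then (1 : ℝ) else 0 with hA
  have hB : (A + l • (1 : Matrix V V ℝ)).IsHermitian := by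
    ext i j
    simp [hA, Matrix.one_apply, G.adj_comm, eq_comm]
  have hpos : (A + l • (1 : Matrix V V ℝ)).PosSemidef := by
    rw [hB.posSemidef_iff_eigenvalues_nonneg]
    intro k
    have hev := hB.mulVec_eigenvectorBasis k
    have hne : (hB.eigenvectorBasis k).ofLp ≠ 0 := by
      intro h
      apply hB.eigenvectorBasis.orthonormal.ne_zero k
      ext i
      exact congrFun h i
    have := hmin (hB.eigenvalues k - l) ⟨_, hne, by
      rw [Matrix.add_mulVec, Matrix.smul_mulVec, Matrix.one_mulVec] at hev
      rw [sub_smul, ← hev, add_sub_cancel_right]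
      simp only [hA]
      congr!⟩
    simp only [Pi.zero_apply]
    linarith
  have h := hpos.dotProduct_mulVec_nonneg w
  rw [Matrix.add_mulVec, Matrix.smul_mulVec, Matrix.one_mulVec] at h
  simpa [dotProduct, Matrix.mulVec, hA, add_comm] using h

/-- Pairing with a function that is constant on a point and on two further disjoint sets. -/
theorem sum_mul_piecewise_three {V : Type*} [Fintype V] [DecidableEq V] (x : V) (N M : Finset V)
    (hxN : x ∉ N) (hxM : x ∉ M) (hNM : Disjoint N M) (a b d : ℝ) (f : V → ℝ) :
    ∑ i, f i * (if i = x then a else if i ∈ N then b else if i ∈ M then d else 0) =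
      a * f x + b * ∑ i ∈ N, f i + d * ∑ i ∈ M, f i := by
  have h : ∀ i, f i * (if i = x then a else if i ∈ N then b else if i ∈ M then d else 0) =
      (if i = x then a * f i else 0) + (if i ∈ N then b * f i else 0) +
        (if i ∈ M then d * f i else 0) := by
    intro i
    by_cases h1 : i = x
    · subst h1
      simp [hxN, hxM, mul_comm]
    · by_cases h2 : i ∈ N
      · simp [h1, h2, Finset.disjoint_left.mp hNM h2, mul_comm]
      · by_cases h3 : i ∈ M <;> simp [h1, h2, h3, mul_comm]
  simp only [h, Finset.sum_add_distrib, Finset.sum_ite_eq', Finset.mem_univ, if_true,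
    Finset.sum_ite_mem, Finset.univ_inter, Finset.mul_sum]

/-- In a clique, the number of neighbours of `i` inside a subset `S`. -/
theorem SimpleGraph.IsClique.sum_adj_subset {V : Type*} [DecidableEq V] {G : SimpleGraph V}
    [DecidableRel G.Adj] {C S : Finset V}
    (hC : G.IsClique (C : Set V)) (hS : S ⊆ C) {i : V} (hi : i ∈ C) :
    ∑ j ∈ S, (if G.Adj i j then (1 : ℝ) else 0) = S.card - if i ∈ S then 1 else 0 := by
  have h : ∀ j ∈ S, (if G.Adj i j then (1 : ℝ) else 0) = 1 - if i = j then 1 else 0 := by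
    intro j hj
    by_cases hij : i = j
    · simp [hij]
    · simp [hij, hC hi (hS hj) hij]
  rw [Finset.sum_congr rfl h, Finset.sum_sub_distrib, Finset.sum_ite_eq]
  simp

/-- The form of `A + l I` on vectors constant on `{x}`, on the neighbours of `x` in the
clique `C`, and on the non-neighbours of `x` in `C`. -/
theorem SimpleGraph.clique_quotient_form_nonneg {V : Type*} [Fintype V] [DecidableEq V]
    (G : SimpleGraph V) [DecidableRel G.Adj] (l : ℝ)
    (hmin : ∀ μ : ℝ, G.adjEigenvalue μ → -l ≤ μ) (C : Finset V) (hC : G.IsClique (C : Set V))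
    (x : V) (hx : x ∉ C) (s m : ℝ) (hs : ((C.filter fun y => G.Adj x y).card : ℝ) = s)
    (hm : ((C.filter fun y => ¬ G.Adj x y).card : ℝ) = m) (a b d : ℝ) :
    0 ≤ l * a ^ 2 + 2 * s * a * b + (s * b + m * d) ^ 2 +
      (l - 1) * (s * b ^ 2 + m * d ^ 2) := by
  set N := C.filter fun y => G.Adj x y with hN
  set M := C.filter fun y => ¬ G.Adj x y with hM
  have hNC : N ⊆ C := Finset.filter_subset _ _
  have hMC : M ⊆ C := Finset.filter_subset _ _
  have hNM : Disjoint N M := Finset.disjoint_filter_filter_not _ _ _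
  have hxN : x ∉ N := fun h => hx (hNC h)
  have hxM : x ∉ M := fun h => hx (hMC h)
  have key := G.quadratic_form_nonneg l hmin
    (fun i => if i = x then a else if i ∈ N then b else if i ∈ M then d else 0)
  have hadjN : ∀ i ∈ N, G.Adj i x := fun i hi => (Finset.mem_filter.mp hi).2.symm
  have hadjM : ∀ i ∈ M, ¬ G.Adj i x := fun i hi h => (Finset.mem_filter.mp hi).2 h.symm
  simp only [sum_mul_piecewise_three x N M hxN hxM hNM] at key
  simp_rw [mul_comm (ite _ _ _)] at key
  rw [sum_mul_piecewise_three x N M hxN hxM hNM] at key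
  have hxN' : ∑ j ∈ N, (if G.Adj x j then (1 : ℝ) else 0) = s := by
    rw [Finset.sum_congr rfl fun j hj => if_pos (hadjN j hj).symm]
    simp [hs]
  have hxM' : ∑ j ∈ M, (if G.Adj x j then (1 : ℝ) else 0) = 0 :=
    Finset.sum_eq_zero fun j hj => if_neg fun h => hadjM j hj h.symm
  rw [hxN', hxM'] at key
  have e1 : ∀ i ∈ N, (l * (if i = x then a else if i ∈ N then b else if i ∈ M then d else 0) +
      (a * (if G.Adj i x then (1 : ℝ) else 0) + b * ∑ j ∈ N, (if G.Adj i j then (1 : ℝ) else 0) +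
        d * ∑ j ∈ M, (if G.Adj i j then (1 : ℝ) else 0))) =
      l * b + (a + b * (s - 1) + d * m) := by
    intro i hi
    have hix : i ≠ x := fun h => hxN (h ▸ hi)
    rw [hC.sum_adj_subset hNC (hNC hi), hC.sum_adj_subset hMC (hNC hi)]
    simp [hix, hi, hadjN i hi, Finset.disjoint_left.mp hNM hi, hs, hm]
  have e2 : ∀ i ∈ M, (l * (if i = x then a else if i ∈ N then b else if i ∈ M then d else 0) +
      (a * (if G.Adj i x then (1 : ℝ) else 0) + b * ∑ j ∈ N, (if G.Adj i j then (1 : ℝ) else 0) +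
        d * ∑ j ∈ M, (if G.Adj i j then (1 : ℝ) else 0))) =
      l * d + (b * s + d * (m - 1)) := by
    intro i hi
    have hix : i ≠ x := fun h => hxM (h ▸ hi)
    rw [hC.sum_adj_subset hNC (hMC hi), hC.sum_adj_subset hMC (hMC hi)]
    simp [hix, hi, hadjM i hi, Finset.disjoint_right.mp hNM hi, hs, hm]
  rw [Finset.sum_congr rfl e1, Finset.sum_congr rfl e2] at key
  simp only [Finset.sum_const, nsmul_eq_mul, hs, hm, if_true, G.loopless.irrefl, if_false] at key
  nlinarith [key]

/-- if some vertex `x` outside a clique `C` of order `c` has exactly `s` neighbors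
in `C` with `λ(λ−1)+1 ≤ s ≤ c − (λ−1)² − 1`, then `c ≤ (λ(λ−1))² + λ(λ−1) + (λ−1)² + 1`. -/
theorem stmt_14 {V : Type*} [Fintype V] [DecidableEq V] (G : SimpleGraph V) [DecidableRel G.Adj]
    (lam : ℕ) (hlam : 1 ≤ lam)
    (hmin : ∀ μ : ℝ, G.adjEigenvalue μ → -(lam : ℝ) ≤ μ)
    (C : Finset V) (hC : G.IsClique (C : Set V))
    (x : V) (hx : x ∉ C) (s : ℕ)
    (hs : (C.filter fun y => G.Adj x y).card = s)
    (hs1 : lam * (lam - 1) + 1 ≤ s) (hs2 : s ≤ C.card - (lam - 1) ^ 2 - 1) :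
    C.card ≤ (lam * (lam - 1)) ^ 2 + lam * (lam - 1) + (lam - 1) ^ 2 + 1 := by
  obtain ⟨k, rfl⟩ : ∃ k, lam = k + 1 := ⟨lam - 1, by omega⟩
  simp only [Nat.add_sub_cancel] at *
  obtain ⟨m, hm⟩ : ∃ m, (C.filter fun y => ¬ G.Adj x y).card = m := ⟨_, rfl⟩
  have hc : s + m = C.card := by
    rw [← hs, ← hm, Finset.card_filter_add_card_filter_not]
  have hm1 : k ^ 2 + 1 ≤ m := by omega
  rw [← hc]
  have form := G.clique_quotient_form_nonneg ((k + 1 : ℕ) : ℝ) hmin C hC x hx s m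
    (by rw [hs]) (by rw [hm])
  have hs1' : ((k : ℝ) + 1) * k + 1 ≤ s := by exact_mod_cast hs1
  have hm1' : (k : ℝ) ^ 2 + 1 ≤ m := by exact_mod_cast hm1
  have hk0 : (0 : ℝ) ≤ k := k.cast_nonneg
  push_cast at form
  rcases Nat.eq_zero_or_pos k with rfl | hk
  · have := form 1 (-m) s
    have hs1' : (1 : ℝ) ≤ s := by simpa using hs1'
    have hm1' : (1 : ℝ) ≤ m := by simpa using hm1'
    push_cast at this
    nlinarith [mul_nonneg (sub_nonneg.mpr hs1') (sub_nonneg.mpr hm1')]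
  have hk' : (0 : ℝ) < k := by exact_mod_cast hk
  have hs0 : (0 : ℝ) < s := by nlinarith
  have hm0 : (0 : ℝ) < m := by nlinarith
  have hdet : (s : ℝ) * (k + m) ≤ (k + 1) * k * (k + (s + m)) := by
    have h := form (k * (k + (s + m))) (-(k + m)) s
    have h' : 0 ≤ k * (k + ((s : ℝ) + m)) *
        ((k + 1) * (k * (k + (s + m))) - s * (k + m)) := by
      convert h using 1
      ring
    have := nonneg_of_mul_nonneg_right h' (by positivity)
    linarith
  have : (s : ℝ) + m ≤ ((k + 1) * k) ^ 2 + (k + 1) * k + k ^ 2 + 1 := by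
    nlinarith [mul_nonneg (sub_nonneg.mpr hs1') (sub_nonneg.mpr hm1')]
  exact_mod_cast this
end
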